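/- Let O ⊂ ℝⁿ (n ≥ 2) be a bounded open set, ϰ > 1, σ ∈ C¹(O) with ϰ⁻¹ ≤ σ ≤ ϰ and |∇σ| ≤ ϰ on O, and u ∈ C²(O) with div(σ∇u) = 0 in O. Let δ > 0 and x₀ ∈ O with dist(x₀,∂O) > δ. Then (i) the function r ↦ e^{ϰ² r} H(x₀,r) is nondecreasing on (0,δ], and (ii) for every 0 < r ≤ δ, K(x₀,r) ≤ δ e^{δ ϰ²} H(x₀,r). -/

import Mathlib

open MeasureTheory Metric Set
open scoped RealInnerProductSpace

noncomputable section

abbrev Euc (n : ℕ) := EuclideanSpace ℝ (Fin n)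

/-- Divergence of a vector field on `ℝⁿ`. -/
noncomputable def vdiv {n : ℕ} (F : Euc n → Euc n) (x : Euc n) : ℝ :=
  ∑ i, fderiv ℝ F x (EuclideanSpace.single i 1) i

/-- Surface integral over the sphere `∂B(x₀,r)`:
`∫_{∂B(x₀,r)} f dS = r^{n−1} ∫_{S^{n−1}} f(x₀+rθ) dσ(θ)`, where `σ` is the
surface measure `volume.toSphere` on the unit sphere. -/
noncomputable def sphIntB (n : ℕ) (x₀ : Euc n) (r : ℝ) (f : Euc n → ℝ) : ℝ :=
  r ^ (n - 1) *
    ∫ θ : Metric.sphere (0 : Euc n) 1, f (x₀ + r • (θ : Euc n))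
      ∂((volume : Measure (Euc n)).toSphere)

/-- `H(x₀,r) = ∫_{∂B(x₀,r)} σ u² dS`. -/
noncomputable def Hfn {n : ℕ} (σ u : Euc n → ℝ) (x₀ : Euc n) (r : ℝ) : ℝ :=
  sphIntB n x₀ r (fun y => σ y * u y ^ 2)

/-- `D(x₀,r) = ∫_{B(x₀,r)} σ |∇u|² dx`. -/
noncomputable def Dfn {n : ℕ} (σ u : Euc n → ℝ) (x₀ : Euc n) (r : ℝ) : ℝ :=
  ∫ x in ball x₀ r, σ x * ‖gradient u x‖ ^ 2

/-- `K(x₀,r) = ∫_{B(x₀,r)} σ u² dx`. -/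
noncomputable def Kfn {n : ℕ} (σ u : Euc n → ℝ) (x₀ : Euc n) (r : ℝ) : ℝ :=
  ∫ x in ball x₀ r, σ x * u x ^ 2

/-- `H̃(x₀,r) = ∫_{∂B(x₀,r)} u² ∇σ·ν dS`, with `ν(x₀+rθ) = θ`. -/
noncomputable def Htilde {n : ℕ} (σ u : Euc n → ℝ) (x₀ : Euc n) (r : ℝ) : ℝ :=
  r ^ (n - 1) *
    ∫ θ : Metric.sphere (0 : Euc n) 1,
      u (x₀ + r • (θ : Euc n)) ^ 2 * ⟪gradient σ (x₀ + r • (θ : Euc n)), (θ : Euc n)⟫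
      ∂((volume : Measure (Euc n)).toSphere)

/-- `Ĥ(x₀,r) = ∫_{∂B(x₀,r)} σ (∂_ν u)² dS`, with `∂_ν u(x₀+rθ) = ∇u(x₀+rθ)·θ`. -/
noncomputable def Hhat {n : ℕ} (σ u : Euc n → ℝ) (x₀ : Euc n) (r : ℝ) : ℝ :=
  r ^ (n - 1) *
    ∫ θ : Metric.sphere (0 : Euc n) 1,
      σ (x₀ + r • (θ : Euc n)) * ⟪gradient u (x₀ + r • (θ : Euc n)), (θ : Euc n)⟫ ^ 2
      ∂((volume : Measure (Euc n)).toSphere)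

/-- `D̃(x₀,r) = ∫_{B(x₀,r)} |∇u|² ∇σ·(x−x₀) dx`. -/
noncomputable def Dtilde {n : ℕ} (σ u : Euc n → ℝ) (x₀ : Euc n) (r : ℝ) : ℝ :=
  ∫ x in ball x₀ r, ‖gradient u x‖ ^ 2 * ⟪gradient σ x, x - x₀⟫

section Polar

variable {E : Type*} [NormedAddCommGroup E] [NormedSpace ℝ E] [FiniteDimensional ℝ E]
  [MeasurableSpace E] [BorelSpace E] [Nontrivial E]

/-- Integration in polar coordinates centred at `x₀`. -/
theorem integral_eq_integral_Ioi_integral_sphere (μ : Measure E) [μ.IsAddHaarMeasure] {f : E → ℝ}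
    (hf : Integrable f μ) (x₀ : E) :
    ∫ x, f x ∂μ = ∫ r in Ioi (0 : ℝ), r ^ (Module.finrank ℝ E - 1) *
      ∫ θ : sphere (0 : E) 1, f (x₀ + r • (θ : E)) ∂μ.toSphere := by
  have hmp := μ.measurePreserving_homeomorphUnitSphereProd
  have hemb := (homeomorphUnitSphereProd E).measurableEmbedding
  set g : sphere (0 : E) 1 × Ioi (0 : ℝ) → ℝ := fun p => f (x₀ + (p.2 : ℝ) • (p.1 : E)) with hg
  have hcomp : ∀ y : ({0}ᶜ : Set E), g (homeomorphUnitSphereProd E y) = f (x₀ + y) := by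
    intro y
    have hy : ‖(y : E)‖ ≠ 0 := norm_ne_zero_iff.2 y.2
    simp [hg, smul_smul, hy]
  have hf' : Integrable (fun y => f (x₀ + y)) μ := hf.comp_add_left x₀
  have hgint : Integrable g (μ.toSphere.prod (.volumeIoiPow (Module.finrank ℝ E - 1))) := by
    rw [← hmp.integrable_comp_emb hemb]
    refine Integrable.congr (f := fun y : ({0}ᶜ : Set E) => f (x₀ + y)) ?_
      (.of_forall fun y => (hcomp y).symm)
    have := hf'.integrableOn (s := ({0}ᶜ : Set E))
    rwa [integrableOn_iff_comap_subtypeVal (measurableSet_singleton _).compl] at this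
  calc ∫ x, f x ∂μ = ∫ y, f (x₀ + y) ∂μ := (integral_add_left_eq_self f x₀).symm
    _ = ∫ y : ({0}ᶜ : Set E), f (x₀ + y) ∂(μ.comap (↑)) := by
      rw [integral_subtype_comap (measurableSet_singleton _).compl fun y => f (x₀ + y),
        restrict_compl_singleton]
    _ = ∫ p, g p ∂(μ.toSphere.prod (.volumeIoiPow (Module.finrank ℝ E - 1))) := by
      rw [← hmp.integral_comp hemb]
      exact integral_congr_ae (.of_forall fun y => (hcomp y).symm)
    _ = ∫ r : Ioi (0 : ℝ), ∫ θ, g (θ, r) ∂μ.toSphere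
          ∂(.volumeIoiPow (Module.finrank ℝ E - 1)) := integral_prod_symm _ hgint
    _ = _ := by
      simp only [Measure.volumeIoiPow, ENNReal.ofReal]
      rw [integral_withDensity_eq_integral_smul
          (measurable_subtype_coe.pow_const _).real_toNNReal,
        integral_subtype_comap measurableSet_Ioi fun a : ℝ =>
          Real.toNNReal (a ^ (Module.finrank ℝ E - 1)) •
            ∫ θ : sphere (0 : E) 1, f (x₀ + a • (θ : E)) ∂μ.toSphere]
      refine setIntegral_congr_fun measurableSet_Ioi fun x hx => ?_
      simp only [NNReal.smul_def, Real.coe_toNNReal _ (pow_nonneg (le_of_lt hx) _), smul_eq_mul]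

end Polar

/-- Differentiation under the integral sign for spherical means. -/
theorem hasDerivAt_integral_sphere {E : Type*} [NormedAddCommGroup E] [NormedSpace ℝ E]
    [FiniteDimensional ℝ E] [MeasurableSpace E] [BorelSpace E]
    (μ : Measure (sphere (0 : E) 1)) [IsFiniteMeasure μ] {P : E → ℝ} (hP : ContDiff ℝ 1 P)
    (x₀ : E) (r : ℝ) :
    HasDerivAt (fun t : ℝ => ∫ θ : sphere (0 : E) 1, P (x₀ + t • (θ : E)) ∂μ)
      (∫ θ : sphere (0 : E) 1, fderiv ℝ P (x₀ + r • (θ : E)) θ ∂μ) r := by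
  have hdP : Continuous (fderiv ℝ P) := hP.continuous_fderiv one_ne_zero
  have hcont : Continuous fun p : ℝ × sphere (0 : E) 1 =>
      fderiv ℝ P (x₀ + p.1 • (p.2 : E)) p.2 := by fun_prop
  obtain ⟨C, hC⟩ := ((isCompact_closedBall r 1).prod
    (isCompact_univ (X := sphere (0 : E) 1))).exists_bound_of_continuousOn hcont.continuousOn
  have hint : ∀ {f : sphere (0 : E) 1 → ℝ}, Continuous f → Integrable f μ := fun hf =>
    hf.integrable_of_hasCompactSupport (HasCompactSupport.of_compactSpace _)
  have hPc := hP.continuous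
  refine (hasDerivAt_integral_of_dominated_loc_of_deriv_le (closedBall_mem_nhds r one_pos)
    (.of_forall fun t => (hint (by fun_prop)).aestronglyMeasurable) (hint (by fun_prop))
    (F' := fun t θ => fderiv ℝ P (x₀ + t • (θ : E)) θ)
    (hint (by fun_prop)).aestronglyMeasurable
    (.of_forall fun θ t ht => hC (t, θ) ⟨ht, mem_univ _⟩) (integrable_const C)
    (.of_forall fun θ t _ => ?_)).2
  have h1 : HasDerivAt (fun t : ℝ => x₀ + t • (θ : E)) θ t := by
    simpa using ((hasDerivAt_id t).smul_const (θ : E)).const_add x₀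
  exact ((hP.differentiable one_ne_zero _).hasFDerivAt).comp_hasDerivAt t h1

/-- A `C^m` function on an open set agrees, on any smaller ball, with a global `C^m` function. -/
theorem ContDiffOn.exists_contDiff_eqOn_closedBall {E F : Type*} [NormedAddCommGroup E]
    [NormedSpace ℝ E] [NormedAddCommGroup F] [NormedSpace ℝ F] [HasContDiffBump E] {m : ℕ∞}
    {O : Set E} (hO : IsOpen O) {f : E → F} (hf : ContDiffOn ℝ m f O) {x₀ : E} {r R : ℝ}
    (hr : 0 < r) (hrR : r < R) (hR : closedBall x₀ R ⊆ O) :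
    ∃ g : E → F, ContDiff ℝ m g ∧ EqOn g f (closedBall x₀ r) := by
  let χ : ContDiffBump x₀ := ⟨r, R, hr, hrR⟩
  refine ⟨fun x => χ x • f x, contDiff_iff_contDiffAt.2 fun x => ?_, fun x hx => ?_⟩
  · by_cases hx : x ∈ O
    · exact χ.contDiff.contDiffAt.smul (hf.contDiffAt (hO.mem_nhds hx))
    · have hx' : x ∈ (tsupport χ)ᶜ := by
        rw [χ.tsupport_eq]
        exact fun h => hx (hR h)
      refine (contDiffAt_const (c := (0 : F))).congr_of_eventuallyEq ?_
      filter_upwards [(isClosed_tsupport χ).isOpen_compl.mem_nhds hx'] with y hy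
      rw [image_eq_zero_of_notMem_tsupport hy, zero_smul]
  · simp [χ.one_of_mem_closedBall hx]

theorem fderiv_apply_eq_sum {n : ℕ} (f : Euc n → ℝ) (x v : Euc n) :
    fderiv ℝ f x v = ∑ i, fderiv ℝ f x (EuclideanSpace.single i 1) * v i := by
  conv_lhs => rw [← (EuclideanSpace.basisFun (Fin n) ℝ).sum_repr v]
  simp [mul_comm]

theorem integral_mul_vdiv {n : ℕ} {φ : Euc n → ℝ} {F : Euc n → Euc n} (hφ : ContDiff ℝ 1 φ)
    (hF : ContDiff ℝ 1 F) (hsupp : HasCompactSupport φ) :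
    ∫ x, φ x * vdiv F x = -∫ x, fderiv ℝ φ x (F x) := by
  have hφc := hφ.continuous
  have hFc := hF.continuous
  have hFi : ∀ i, ContDiff ℝ 1 fun y => F y i := fun i =>
    (EuclideanSpace.proj (𝕜 := ℝ) i).contDiff.comp hF
  have hdFi : ∀ i x v, fderiv ℝ (fun y => F y i) x v = fderiv ℝ F x v i := fun i x v => by
    have := ((EuclideanSpace.proj (𝕜 := ℝ) i).hasFDerivAt.comp x
      (hF.differentiable one_ne_zero x).hasFDerivAt).fderiv
    exact congrArg (fun L => L v) this
  have hi1 : ∀ i, Integrable fun x =>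
      φ x * fderiv ℝ (fun y => F y i) x (EuclideanSpace.single i 1) := fun i => by
    have := (hFi i).continuous_fderiv one_ne_zero
    exact Continuous.integrable_of_hasCompactSupport (by fun_prop) hsupp.mul_right
  have hi2 : ∀ i, Integrable fun x =>
      fderiv ℝ φ x (EuclideanSpace.single i 1) * F x i := fun i => by
    have := (hFi i).continuous
    exact Continuous.integrable_of_hasCompactSupport (by fun_prop)
      (hsupp.fderiv_apply ℝ _).mul_right
  have hsum := fun x => fderiv_apply_eq_sum φ x (F x)
  simp only [hsum, vdiv, Finset.mul_sum, ← hdFi]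
  rw [integral_finsetSum _ fun i _ => hi1 i, integral_finsetSum _ fun i _ => hi2 i,
    ← Finset.sum_neg_distrib]
  refine Finset.sum_congr rfl fun i _ => ?_
  refine integral_mul_fderiv_eq_neg_fderiv_mul_of_integrable (hi2 i) (hi1 i) ?_
    (fun x _ => hφ.differentiable one_ne_zero x) (fun x _ => (hFi i).differentiable one_ne_zero x)
  have := (hFi i).continuous
  exact Continuous.integrable_of_hasCompactSupport (by fun_prop) hsupp.mul_right

/-- The outward flux through a sphere of a field with nonnegative divergence is nonnegative. -/
theorem integral_sphere_inner_nonneg {n : ℕ} [Nontrivial (Euc n)] {F : Euc n → Euc n}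
    (hF : ContDiff ℝ 1 F) {x₀ : Euc n} {R ρ : ℝ} (hdiv : ∀ x ∈ ball x₀ R, 0 ≤ vdiv F x)
    (hρ : ρ ∈ Ioo 0 R) :
    0 ≤ ∫ θ : sphere (0 : Euc n) 1, ⟪F (x₀ + ρ • (θ : Euc n)), (θ : Euc n)⟫
      ∂((volume : Measure (Euc n)).toSphere) := by
  set g : ℝ → ℝ := fun r => ∫ θ : sphere (0 : Euc n) 1, ⟪F (x₀ + r • (θ : Euc n)), (θ : Euc n)⟫
      ∂((volume : Measure (Euc n)).toSphere) with hg
  by_contra! hneg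
  have hFc := hF.continuous
  have hgc : Continuous g := by
    have : Continuous fun p : ℝ × sphere (0 : Euc n) 1 =>
        ⟪F (x₀ + p.1 • (p.2 : Euc n)), (p.2 : Euc n)⟫ := by fun_prop
    simpa [hg] using continuous_parametric_integral_of_continuous (s := univ)
      (μ := (volume : Measure (Euc n)).toSphere) this isCompact_univ
  obtain ⟨l, m, hlm, hsub⟩ := mem_nhds_iff_exists_Ioo_subset.1
    (Filter.inter_mem (hgc.continuousAt.eventually_lt continuousAt_const hneg)
      (Ioo_mem_nhds hρ.1 hρ.2))
  have hlm' : l < m := hlm.1.trans hlm.2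
  have hIoo : Ioo l m ⊆ Ioo 0 R := fun x hx => (hsub hx).2
  obtain ⟨hl, hm⟩ := (Ioo_subset_Ioo_iff hlm').1 hIoo
  have hm0 : 0 < m := hl.trans_lt hlm'
  set w : ℝ → ℝ := fun t => max 0 (t - l ^ 2) * max 0 (m ^ 2 - t) with hw
  have hwc : Continuous w := by fun_prop
  have hw0 : ∀ t, 0 ≤ w t := fun t => mul_nonneg (le_max_left _ _) (le_max_left _ _)
  have hwm : ∀ t, m ^ 2 ≤ t → w t = 0 := fun t ht => by simp [hw, ht]
  have hwl : ∀ t, t ≤ l ^ 2 → w t = 0 := fun t ht => by simp [hw, ht]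
  set Φ : ℝ → ℝ := fun s => ∫ t in s..m ^ 2, w t with hΦ
  have hΦd : ∀ s, HasDerivAt Φ (-w s) s := fun s =>
    intervalIntegral.integral_hasDerivAt_left (hwc.intervalIntegrable _ _)
      (hwc.stronglyMeasurableAtFilter _ _) hwc.continuousAt
  have hΦ1 : ContDiff ℝ 1 Φ := contDiff_one_iff_deriv.2
    ⟨fun s => (hΦd s).differentiableAt, by
      rw [funext fun s => (hΦd s).deriv]
      exact hwc.neg⟩
  have hΦm : ∀ s, m ^ 2 ≤ s → Φ s = 0 := fun s h => by
    refine (intervalIntegral.integral_congr (g := fun _ => (0 : ℝ)) fun t ht => ?_).trans (by simp)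
    rw [uIcc_of_ge h] at ht
    exact hwm t ht.1
  have hΦ0 : ∀ s, 0 ≤ Φ s := fun s => by
    rcases le_total s (m ^ 2) with h | h
    · exact intervalIntegral.integral_nonneg h fun t _ => hw0 t
    · exact (hΦm s h).ge
  set φ : Euc n → ℝ := fun x => Φ (‖x - x₀‖ ^ 2) with hφ
  have hφ1 : ContDiff ℝ 1 φ := hΦ1.comp ((contDiff_id.sub contDiff_const).norm_sq ℝ)
  have hφd : ∀ x v, fderiv ℝ φ x v = -(w (‖x - x₀‖ ^ 2) * (2 * ⟪x - x₀, v⟫)) := fun x v => by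
    have h1 : HasFDerivAt (fun x : Euc n => ‖x - x₀‖ ^ 2) (2 • (innerSL ℝ (x - x₀))) x := by
      simpa only [ContinuousLinearMap.comp_id] using
        HasFDerivAt.norm_sq (f := fun x : Euc n => x - x₀) ((hasFDerivAt_id x).sub_const x₀)
    rw [show fderiv ℝ φ x = _ from ((hΦd _).comp_hasFDerivAt x h1).fderiv]
    simp only [_root_.smul_apply, innerSL_apply_apply, smul_eq_mul, nsmul_eq_mul,
      Nat.cast_ofNat, neg_mul]
  have hball : ∀ x, x ∉ ball x₀ m → m ^ 2 ≤ ‖x - x₀‖ ^ 2 := fun x hx => by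
    rw [mem_ball, dist_eq_norm, not_lt] at hx
    exact pow_le_pow_left₀ hm0.le hx 2
  have hsupp : HasCompactSupport φ :=
    HasCompactSupport.intro (isCompact_closedBall x₀ m) fun x hx =>
      hΦm _ (hball x fun h => hx (ball_subset_closedBall h))
  have hpos : 0 ≤ ∫ x, φ x * vdiv F x := integral_nonneg fun x => by
    by_cases hx : x ∈ ball x₀ m
    · exact mul_nonneg (hΦ0 _) (hdiv x (ball_subset_ball hm hx))
    · simp [hφ, hΦm _ (hball x hx)]
  have hint : Integrable fun x => w (‖x - x₀‖ ^ 2) * (2 * ⟪x - x₀, F x⟫) :=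
    Continuous.integrable_of_hasCompactSupport (by fun_prop)
      (HasCompactSupport.intro (isCompact_closedBall x₀ m) fun x hx => by
        rw [hwm _ (hball x fun h => hx (ball_subset_closedBall h)), zero_mul])
  rw [integral_mul_vdiv hφ1 hF hsupp] at hpos
  simp only [hφd, integral_neg, neg_neg] at hpos
  rw [integral_eq_integral_Ioi_integral_sphere volume hint x₀] at hpos
  set k : ℝ → ℝ := fun r => r ^ (n - 1) * (w (r ^ 2) * (2 * r) * g r) with hk
  have hkc : Continuous k := by fun_prop
  have hkeq : ∀ r : ℝ, r ^ (Module.finrank ℝ (Euc n) - 1) *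
      ∫ θ : sphere (0 : Euc n) 1, w (‖x₀ + r • (θ : Euc n) - x₀‖ ^ 2) *
        (2 * ⟪x₀ + r • (θ : Euc n) - x₀, F (x₀ + r • (θ : Euc n))⟫)
        ∂((volume : Measure (Euc n)).toSphere) = k r := fun r => by
    simp only [hk, hg, finrank_euclideanSpace_fin, ← integral_const_mul]
    refine integral_congr_ae (.of_forall fun θ => ?_)
    simp only [add_sub_cancel_left, norm_smul, norm_eq_of_mem_sphere, mul_one, Real.norm_eq_abs,
      sq_abs, real_inner_smul_left, real_inner_comm (θ : Euc n)]
    ring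
  simp only [hkeq] at hpos
  rw [setIntegral_eq_of_subset_of_forall_sdiff_eq_zero measurableSet_Ioi
    (s := Ioc l m) (fun x hx => hl.trans_lt hx.1) (fun x hx => ?_),
    ← intervalIntegral.integral_of_le hlm'.le] at hpos
  · have := intervalIntegral.intervalIntegral_pos_of_pos_on (f := fun r => -k r)
      (hkc.neg.intervalIntegrable l m) (fun r hr => ?_) hlm'
    · rw [intervalIntegral.integral_neg] at this
      linarith
    · have hr0 : 0 < r := hl.trans_lt hr.1
      have h1 : g r < 0 := (hsub hr).1
      have h2 : 0 < w (r ^ 2) := mul_pos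
        (lt_max_of_lt_right (sub_pos.2 (pow_lt_pow_left₀ hr.1 hl two_ne_zero)))
        (lt_max_of_lt_right (sub_pos.2 (pow_lt_pow_left₀ hr.2 hr0.le two_ne_zero)))
      rw [hk, ← mul_neg, ← mul_neg]
      have : 0 < -g r := neg_pos.2 h1
      positivity
  · have hx0 : 0 < x := hx.1
    have : w (x ^ 2) = 0 := by
      rcases le_or_gt x l with h | h
      · exact hwl _ (pow_le_pow_left₀ hx0.le h 2)
      · exact hwm _ (pow_le_pow_left₀ hm0.le (not_le.1 fun h' => hx.2 ⟨h, h'⟩).le 2)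
    simp [hk, this]

theorem ContDiffOn.gradient {n : ℕ} {O : Set (Euc n)} (hO : IsOpen O) {f : Euc n → ℝ}
    (hf : ContDiffOn ℝ 2 f O) : ContDiffOn ℝ 1 (gradient f) O :=
  (InnerProductSpace.toDual ℝ (Euc n)).symm.contDiff.comp_contDiffOn
    (hf.fderiv_of_isOpen hO (by norm_num))

theorem vdiv_smul {n : ℕ} {f : Euc n → ℝ} {V : Euc n → Euc n} {x : Euc n}
    (hf : DifferentiableAt ℝ f x) (hV : DifferentiableAt ℝ V x) :
    vdiv (fun y => f y • V y) x = f x * vdiv V x + ⟪gradient f x, V x⟫ := by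
  rw [inner_gradient_left, fderiv_apply_eq_sum, vdiv, vdiv, fderiv_fun_smul hf hV,
    Finset.mul_sum, ← Finset.sum_add_distrib]
  simp

theorem Filter.EventuallyEq.vdiv_eq {n : ℕ} {F G : Euc n → Euc n} {x : Euc n}
    (h : F =ᶠ[nhds x] G) : vdiv F x = vdiv G x := by
  rw [vdiv, vdiv, h.fderiv_eq]

theorem ball_infDist_frontier_subset {E : Type*} [NormedAddCommGroup E] [NormedSpace ℝ E]
    {O : Set E} (hO : IsOpen O) {x : E} (hx : x ∈ O) : ball x (infDist x (frontier O)) ⊆ O := by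
  rcases (infDist_nonneg (x := x) (s := frontier O)).eq_or_lt with h | h
  · simp [← h]
  refine (convex_ball x _).isPreconnected.subset_left_of_subset_union hO
    isClosed_closure.isOpen_compl (disjoint_compl_right.mono_left subset_closure)
    (fun y hy => ?_) ⟨x, mem_ball_self h, hx⟩
  by_contra! hy'
  rw [mem_union, not_or, notMem_compl_iff] at hy'
  exact ball_infDist_subset_compl hy (by rw [hO.frontier_eq]; exact ⟨hy'.2, hy'.1⟩)

/-- The weight `e^{cr}` makes the `σ`-weighted spherical integral of `u²` monotone. -/
theorem monotoneOn_exp_mul_Hfn {n : ℕ} [Nontrivial (Euc n)] {O : Set (Euc n)} (hO : IsOpen O)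
    {c : ℝ} {σ u : Euc n → ℝ} (hσ : ContDiffOn ℝ 1 σ O) (hσ0 : ∀ x ∈ O, 0 ≤ σ x)
    (hgradσ : ∀ x ∈ O, ‖gradient σ x‖ ≤ c * σ x) (hu : ContDiffOn ℝ 2 u O)
    (hpde : ∀ x ∈ O, vdiv (fun y => σ y • gradient u y) x = 0) {x₀ : Euc n} {r R : ℝ}
    (hrR : r < R) (hR : closedBall x₀ R ⊆ O) :
    MonotoneOn (fun t => Real.exp (c * t) * Hfn σ u x₀ t) (Ioo 0 r) := by
  rcases le_or_gt r 0 with hr | hr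
  · simp [Ioo_eq_empty (not_lt.2 hr), MonotoneOn]
  have hrO : closedBall x₀ r ⊆ O := (closedBall_subset_closedBall hrR.le).trans hR
  have hu1 : ContDiffOn ℝ 1 u O := hu.of_le (by norm_num)
  have hV : ContDiffOn ℝ 1 (fun y => σ y • gradient u y) O := hσ.smul (hu.gradient hO)
  obtain ⟨P, hP, hPeq⟩ := ContDiffOn.exists_contDiff_eqOn_closedBall (m := 1) hO
    (hσ.mul (hu1.pow 2)) hr hrR hR
  obtain ⟨F, hF, hFeq⟩ := ContDiffOn.exists_contDiff_eqOn_closedBall (m := 1) hO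
    (hu1.smul hV) hr hrR hR
  have hP : ContDiff ℝ 1 P := hP
  have hF : ContDiff ℝ 1 F := hF
  have hdO : ∀ {f : Euc n → ℝ}, ContDiffOn ℝ 1 f O → ∀ x ∈ O, DifferentiableAt ℝ f x :=
    fun hf x hx => (hf.contDiffAt (hO.mem_nhds hx)).differentiableAt one_ne_zero
  have hball : ∀ x ∈ ball x₀ r, closedBall x₀ r ∈ nhds x := fun x hx =>
    Filter.mem_of_superset (isOpen_ball.mem_nhds hx) ball_subset_closedBall
  have hdiv : ∀ x ∈ ball x₀ r, 0 ≤ vdiv F x := fun x hx => by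
    have hxO := hrO (ball_subset_closedBall hx)
    rw [(hFeq.eventuallyEq_of_mem (hball x hx)).vdiv_eq]
    refine (vdiv_smul (hdO hu1 x hxO)
      ((hV.contDiffAt (hO.mem_nhds hxO)).differentiableAt one_ne_zero)).symm ▸ ?_
    rw [hpde x hxO, mul_zero, zero_add, real_inner_smul_right, real_inner_self_eq_norm_sq]
    exact mul_nonneg (hσ0 x hxO) (sq_nonneg _)
  have hdP : ∀ x ∈ ball x₀ r, ∀ v : Euc n, ‖v‖ = 1 →
      2 * ⟪F x, v⟫ - c * P x ≤ fderiv ℝ P x v := fun x hx v hv => by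
    have hx' := ball_subset_closedBall hx
    have hxO := hrO hx'
    rw [(hPeq.eventuallyEq_of_mem (hball x hx)).fderiv_eq, hPeq hx', hFeq hx']
    have h := ((hdO hσ x hxO).hasFDerivAt.mul ((hdO hu1 x hxO).hasFDerivAt.pow 2)).fderiv
    refine h.symm ▸ ?_
    simp only [_root_.add_apply, _root_.smul_apply, smul_eq_mul, ← inner_gradient_left,
      real_inner_smul_left, nsmul_eq_mul, Pi.smul_apply']
    have h1 : -(c * σ x) ≤ ⟪gradient σ x, v⟫ := by
      have h2 := abs_real_inner_le_norm (gradient σ x) v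
      rw [hv, mul_one] at h2
      exact (abs_le.1 (h2.trans (hgradσ x hxO))).1
    have h3 := mul_le_mul_of_nonneg_left h1 (sq_nonneg (u x))
    simp only [Nat.reduceSub, pow_one, Nat.cast_ofNat]
    linarith
  set μ := (volume : Measure (Euc n)).toSphere with hμ
  set p : ℝ → ℝ := fun t => ∫ θ : sphere (0 : Euc n) 1, P (x₀ + t • (θ : Euc n)) ∂μ with hp
  set q : ℝ → ℝ := fun t =>
    ∫ θ : sphere (0 : Euc n) 1, fderiv ℝ P (x₀ + t • (θ : Euc n)) θ ∂μ with hq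
  have hpd : ∀ t, HasDerivAt p (q t) t := hasDerivAt_integral_sphere μ hP x₀
  have hmem : ∀ t ∈ Ioo 0 r, ∀ θ : sphere (0 : Euc n) 1, x₀ + t • (θ : Euc n) ∈ ball x₀ r :=
    fun t ht θ => by simpa [norm_smul, abs_of_pos ht.1] using ht.2
  have hHp : ∀ t ∈ Ioo 0 r, Hfn σ u x₀ t = t ^ (n - 1) * p t := fun t ht => by
    rw [Hfn, sphIntB, hp]
    congr 1
    exact integral_congr_ae
      (.of_forall fun θ => (hPeq (ball_subset_closedBall (hmem t ht θ))).symm)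
  have hp0 : ∀ t ∈ Ioo 0 r, 0 ≤ p t := fun t ht => integral_nonneg fun θ => by
    have hθ := ball_subset_closedBall (hmem t ht θ)
    simp only [hPeq hθ]
    exact mul_nonneg (hσ0 _ (hrO hθ)) (sq_nonneg _)
  have hqp : ∀ t ∈ Ioo 0 r, 0 ≤ c * p t + q t := fun t ht => by
    have hint : ∀ {f : sphere (0 : Euc n) 1 → ℝ}, Continuous f → Integrable f μ := fun hf =>
      hf.integrable_of_hasCompactSupport (HasCompactSupport.of_compactSpace _)
    have hPc := hP.continuous
    have hFc := hF.continuous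
    have hdPc := hP.continuous_fderiv one_ne_zero
    have hi1 : Integrable (fun θ : sphere (0 : Euc n) 1 =>
      ⟪F (x₀ + t • (θ : Euc n)), (θ : Euc n)⟫) μ := hint (by fun_prop)
    have hi2 : Integrable (fun θ : sphere (0 : Euc n) 1 =>
      P (x₀ + t • (θ : Euc n))) μ := hint (by fun_prop)
    have h := integral_mono ((hi1.const_mul 2).sub (hi2.const_mul c)) (hint (by fun_prop))
      fun θ => hdP _ (hmem t ht θ) θ (norm_eq_of_mem_sphere θ)
    rw [integral_sub' (hi1.const_mul 2) (hi2.const_mul c), integral_const_mul,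
      integral_const_mul] at h
    have := integral_sphere_inner_nonneg hF hdiv ht
    linarith
  have hmono : MonotoneOn (fun t => Real.exp (c * t) * (t ^ (n - 1) * p t)) (Ioo 0 r) := by
    have hd : ∀ t, HasDerivAt (fun t => Real.exp (c * t) * (t ^ (n - 1) * p t))
        (Real.exp (c * t) * c * (t ^ (n - 1) * p t) +
          Real.exp (c * t) * (((n - 1 : ℕ) : ℝ) * t ^ (n - 1 - 1) * p t + t ^ (n - 1) * q t)) t :=
      fun t => by
        have h1 : HasDerivAt (fun t => Real.exp (c * t)) (Real.exp (c * t) * c) t := by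
          simpa using ((hasDerivAt_id t).const_mul c).exp
        exact h1.mul ((hasDerivAt_pow (n - 1) t).mul (hpd t))
    refine monotoneOn_of_deriv_nonneg (convex_Ioo 0 r)
      (fun t _ => (hd t).continuousAt.continuousWithinAt)
      (fun t _ => (hd t).differentiableAt.differentiableWithinAt) fun t ht => ?_
    rw [interior_Ioo] at ht
    rw [(hd t).deriv]
    have ht0 := ht.1
    have := hqp t ht
    have := hp0 t ht
    calc 0 ≤ Real.exp (c * t) * (t ^ (n - 1) * (c * p t + q t) +
          ((n - 1 : ℕ) : ℝ) * t ^ (n - 1 - 1) * p t) := by positivity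
      _ = _ := by ring
  exact hmono.congr fun t ht => by simp only [hHp t ht]

theorem Hfn_nonneg {n : ℕ} {σ u : Euc n → ℝ} {x₀ : Euc n} {r : ℝ} (hr : 0 ≤ r)
    (hσ0 : ∀ x ∈ closedBall x₀ r, 0 ≤ σ x) : 0 ≤ Hfn σ u x₀ r :=
  mul_nonneg (pow_nonneg hr _) (integral_nonneg fun θ =>
    mul_nonneg (hσ0 _ (by simp [norm_smul, abs_of_nonneg hr])) (sq_nonneg _))

theorem Kfn_eq_setIntegral_Hfn {n : ℕ} [Nontrivial (Euc n)] {σ u : Euc n → ℝ} {x₀ : Euc n} {r : ℝ}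
    (hint : IntegrableOn (fun x => σ x * u x ^ 2) (ball x₀ r)) :
    Kfn σ u x₀ r = ∫ t in Ioo 0 r, Hfn σ u x₀ t := by
  rw [Kfn, ← integral_indicator measurableSet_ball,
    integral_eq_integral_Ioi_integral_sphere volume (hint.integrable_indicator measurableSet_ball)
      x₀]
  have hmem : ∀ t : ℝ, 0 < t → ∀ θ : sphere (0 : Euc n) 1,
      x₀ + t • (θ : Euc n) ∈ ball x₀ r ↔ t < r := fun t ht θ => by
    simp [norm_smul, abs_of_pos ht]
  rw [setIntegral_eq_of_subset_of_forall_sdiff_eq_zero measurableSet_Ioi (s := Ioo 0 r)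
    (fun t ht => ht.1) fun t ht => ?_]
  · refine setIntegral_congr_fun measurableSet_Ioo fun t ht => ?_
    simp [Hfn, sphIntB, indicator, hmem t ht.1, ht.2]
  · have htr : ¬ t < r := fun h => ht.2 ⟨ht.1, h⟩
    simp [indicator, hmem t ht.1, htr]

/-- (i) `r ↦ e^{ϰ²r} H(x₀,r)` is nondecreasing on `(0,δ]`; (ii) `K ≤ δ e^{δϰ²} H`. -/
theorem stmt13 (n : ℕ) (hn : 2 ≤ n) (O : Set (Euc n)) (hO : IsOpen O)
    (hObd : Bornology.IsBounded O) (ϰ : ℝ) (hϰ : 1 < ϰ) (σ u : Euc n → ℝ)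
    (hσ : ContDiffOn ℝ 1 σ O)
    (hσbd : ∀ x ∈ O, ϰ⁻¹ ≤ σ x ∧ σ x ≤ ϰ)
    (hgradσ : ∀ x ∈ O, ‖gradient σ x‖ ≤ ϰ)
    (hu : ContDiffOn ℝ 2 u O)
    (hpde : ∀ x ∈ O, vdiv (fun y => σ y • gradient u y) x = 0)
    (δ : ℝ) (hδ : 0 < δ) (x₀ : Euc n) (hx₀ : x₀ ∈ O)
    (hx₀δ : δ < infDist x₀ (frontier O)) :
    MonotoneOn (fun r => Real.exp (ϰ ^ 2 * r) * Hfn σ u x₀ r) (Ioc (0 : ℝ) δ) ∧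
    ∀ r ∈ Ioc (0 : ℝ) δ,
      Kfn σ u x₀ r ≤ δ * Real.exp (δ * ϰ ^ 2) * Hfn σ u x₀ r := by
  have : Nontrivial (Euc n) := Module.nontrivial_of_finrank_pos (R := ℝ) (by simp; lia)
  have hϰ0 : 0 < ϰ := one_pos.trans hϰ
  have hσ0 : ∀ x ∈ O, 0 ≤ σ x := fun x hx => (inv_pos.2 hϰ0).le.trans (hσbd x hx).1
  have hgrad : ∀ x ∈ O, ‖gradient σ x‖ ≤ ϰ ^ 2 * σ x := fun x hx => by
    refine (hgradσ x hx).trans ?_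
    calc ϰ = ϰ ^ 2 * ϰ⁻¹ := by field_simp
      _ ≤ ϰ ^ 2 * σ x := mul_le_mul_of_nonneg_left (hσbd x hx).1 (sq_nonneg ϰ)
  obtain ⟨R, hδR, hR⟩ := exists_between hx₀δ
  obtain ⟨r₁, hδr₁, hr₁R⟩ := exists_between hδR
  have hRO : closedBall x₀ R ⊆ O :=
    (closedBall_subset_ball hR).trans (ball_infDist_frontier_subset hO hx₀)
  have hmono : MonotoneOn (fun r => Real.exp (ϰ ^ 2 * r) * Hfn σ u x₀ r) (Ioc 0 δ) :=
    (monotoneOn_exp_mul_Hfn hO hσ hσ0 hgrad hu hpde hr₁R hRO).mono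
      fun t ht => ⟨ht.1, ht.2.trans_lt hδr₁⟩
  refine ⟨hmono, fun r hr => ?_⟩
  have hsub : ∀ t ≤ δ, closedBall x₀ t ⊆ O := fun t ht =>
    (closedBall_subset_closedBall (ht.trans hδR.le)).trans hRO
  have hH0 : ∀ t ∈ Ioc 0 δ, 0 ≤ Hfn σ u x₀ t := fun t ht =>
    Hfn_nonneg ht.1.le fun x hx => hσ0 x (hsub t ht.2 hx)
  have hint : IntegrableOn (fun x => σ x * u x ^ 2) (ball x₀ r) :=
    (((hσ.continuousOn.mul (hu.continuousOn.pow 2)).mono (hsub r hr.2)).integrableOn_compact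
      (isCompact_closedBall x₀ r)).mono_set ball_subset_closedBall
  have hbound : ∀ t ∈ Ioo 0 r, ‖Hfn σ u x₀ t‖ ≤ Real.exp (δ * ϰ ^ 2) * Hfn σ u x₀ r :=
    fun t ht => by
      have htδ : t ∈ Ioc 0 δ := ⟨ht.1, ht.2.le.trans hr.2⟩
      rw [Real.norm_of_nonneg (hH0 t htδ)]
      have h1 : 1 ≤ Real.exp (ϰ ^ 2 * t) := Real.one_le_exp (mul_nonneg (sq_nonneg ϰ) ht.1.le)
      calc Hfn σ u x₀ t ≤ Real.exp (ϰ ^ 2 * t) * Hfn σ u x₀ t :=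
            le_mul_of_one_le_left (hH0 t htδ) h1
        _ ≤ Real.exp (ϰ ^ 2 * r) * Hfn σ u x₀ r := hmono htδ hr ht.2.le
        _ ≤ Real.exp (δ * ϰ ^ 2) * Hfn σ u x₀ r := by
            refine mul_le_mul_of_nonneg_right (Real.exp_le_exp.2 ?_) (hH0 r hr)
            rw [mul_comm]
            exact mul_le_mul_of_nonneg_right hr.2 (sq_nonneg ϰ)
  rw [Kfn_eq_setIntegral_Hfn hint]
  calc ∫ t in Ioo 0 r, Hfn σ u x₀ t ≤ ‖∫ t in Ioo 0 r, Hfn σ u x₀ t‖ := Real.le_norm_self _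
    _ ≤ Real.exp (δ * ϰ ^ 2) * Hfn σ u x₀ r * volume.real (Ioo 0 r) :=
        norm_setIntegral_le_of_norm_le_const measure_Ioo_lt_top hbound
    _ = r * (Real.exp (δ * ϰ ^ 2) * Hfn σ u x₀ r) := by
        rw [Real.volume_real_Ioo_of_le hr.1.le, sub_zero, mul_comm]
    _ ≤ δ * (Real.exp (δ * ϰ ^ 2) * Hfn σ u x₀ r) :=
        mul_le_mul_of_nonneg_right hr.2 (mul_nonneg (Real.exp_pos _).le (hH0 r hr))
    _ = δ * Real.exp (δ * ϰ ^ 2) * Hfn σ u x₀ r := by ring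

end
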